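/- Consider M jointly realizable linear regression tasks with data radius R > 0, and let w⋆ satisfy X_m w⋆ = y_m for all m. Fix a step size γ ∈ (0, 1/R²), an integer budget N ≥ 1, and k ≥ 1, let τ be a random with-replacement ordering of length k, and let w_0, w_1, …, w_k be the budgeted continual linear regression iterates with constant parameters γ_t = γ, N_t = N, started from an arbitrary w_0 ∈ ℝ^d. Set Q = 1 − (1 − γR²)^N. Then the expected average loss of the final iterate satisfies E_τ L(w_k) ≤ e·‖w_0 − w⋆‖²·R² / (2·(1 − (1 − γR²)^{2N})·k^{1 − Q(1 − Q/4)}). -/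

import Mathlib

open Matrix

/-- Matrix-vector multiplication viewed as a map between Euclidean spaces. -/
noncomputable def mulVecE {n d : ℕ} (X : Matrix (Fin n) (Fin d) ℝ)
    (v : EuclideanSpace ℝ (Fin d)) : EuclideanSpace ℝ (Fin n) :=
  (WithLp.equiv 2 (Fin n → ℝ)).symm (X.mulVec (WithLp.equiv 2 (Fin d → ℝ) v))


section helpers

/-- Averaging operator over tasks. -/
noncomputable def avgOp {E : Type*} {M : ℕ} (U : Fin M → E → E) (g : E → ℝ) : E → ℝ :=
  fun v => (∑ m, g (U m v)) / (M : ℝ)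

lemma sum_paths {E : Type*} {M : ℕ} (hM : 0 < M) (U : Fin M → E → E) (g : E → ℝ) (k : ℕ) :
    ∀ (w0 : E) (w : (Fin k → Fin M) → ℕ → E) (_ : ∀ τ, w τ 0 = w0)
      (_ : ∀ (τ : Fin k → Fin M) (t : Fin k), w τ (t.1 + 1) = U (τ t) (w τ t.1)),
      (∑ τ, g (w τ k)) / (M : ℝ) ^ k = (avgOp U)^[k] g w0 := by
  induction k with
  | zero =>
    intro w0 w h0 _
    simp [h0]
  | succ k ih =>
    intro w0 w h0 h1
    have hM' : (M : ℝ) ≠ 0 := by positivity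
    rw [Function.iterate_succ_apply']
    have h2 : ∀ m, (∑ τ : Fin k → Fin M, g (w (Fin.cons m τ : Fin (k+1) → Fin M) (k + 1))) / (M : ℝ) ^ k
        = (avgOp U)^[k] g (U m w0) := by
      intro m
      apply ih (U m w0) (fun τ t => w (Fin.cons m τ : Fin (k+1) → Fin M) (t + 1))
      · intro τ
        have := h1 (Fin.cons m τ : Fin (k+1) → Fin M) 0
        simpa [h0] using this
      · intro τ t
        have := h1 (Fin.cons m τ : Fin (k+1) → Fin M) t.succ
        simpa using this
    have h3 : ∑ τ, g (w τ (k+1)) = ∑ m, ∑ τ : Fin k → Fin M,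
        g (w (Fin.cons m τ : Fin (k+1) → Fin M) (k + 1)) := by
      rw [← Fintype.sum_prod_type']
      symm
      exact Fintype.sum_equiv (Fin.consEquiv (fun _ : Fin (k+1) => Fin M)) _ _ (fun x => rfl)
    rw [h3]
    simp only [avgOp, ← h2]
    rw [← Finset.sum_div, div_div, pow_succ]

lemma avgOp_mono {E : Type*} {M : ℕ} (U : Fin M → E → E) {g h : E → ℝ}
    (H : ∀ v, g v ≤ h v) (v : E) : avgOp U g v ≤ avgOp U h v := by
  unfold avgOp
  gcongr
  exact H _

lemma avgOp_iter_mono {E : Type*} {M : ℕ} (U : Fin M → E → E) (k : ℕ) :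
    ∀ {g h : E → ℝ} (_ : ∀ v, g v ≤ h v) (v : E), (avgOp U)^[k] g v ≤ (avgOp U)^[k] h v := by
  induction k with
  | zero => intro g h H v; simpa using H v
  | succ k ih =>
    intro g h H v
    simp only [Function.iterate_succ_apply]
    exact ih (avgOp_mono U H) v

lemma avgOp_iter_add {E : Type*} {M : ℕ} (U : Fin M → E → E) (k : ℕ) :
    ∀ (g h : E → ℝ) (a : ℝ) (v : E), (avgOp U)^[k] (fun u => g u + a * h u) v
      = (avgOp U)^[k] g v + a * (avgOp U)^[k] h v := by
  induction k with
  | zero => intro g h a v; simp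
  | succ k ih =>
    intro g h a v
    simp only [Function.iterate_succ_apply]
    rw [← ih]
    refine congrFun (congrArg _ ?_) v
    funext u
    simp only [avgOp, Finset.sum_add_distrib, ← Finset.mul_sum]
    ring

lemma avgOp_iter_const {E : Type*} {M : ℕ} (hM : 0 < M) (U : Fin M → E → E) (k : ℕ) (c : ℝ) :
    ∀ (v : E), (avgOp U)^[k] (fun _ => c) v = c := by
  induction k with
  | zero => intro v; simp
  | succ k ih =>
    intro v
    have hM' : (M : ℝ) ≠ 0 := by positivity
    rw [Function.iterate_succ_apply]
    have : avgOp U (fun _ => c) = fun _ => c := by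
      funext u; simp [avgOp]; field_simp
    rw [this]; exact ih v

lemma avgOp_telescope {E : Type*} {M : ℕ} (hM : 0 < M) (U : Fin M → E → E)
    (g φ : E → ℝ) (a c : ℝ) (hg : ∀ v, 0 ≤ g v)
    (H : ∀ v, avgOp U g v ≤ g v - a * φ v + c) (n : ℕ) (v : E) :
    a * ∑ t ∈ Finset.range n, (avgOp U)^[t] φ v ≤ g v + n * c := by
  have key : a * ∑ t ∈ Finset.range n, (avgOp U)^[t] φ v + (avgOp U)^[n] g v ≤ g v + n * c := by
    induction n with
    | zero => simp
    | succ n ih =>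
      rw [Finset.sum_range_succ, Function.iterate_succ_apply]
      have h1 := avgOp_iter_mono U n H v
      have h2 : (avgOp U)^[n] (fun v => g v - a * φ v + c) v
          = (avgOp U)^[n] g v + (-a) * (avgOp U)^[n] φ v + c := by
        have e : (fun v => g v - a * φ v + c) =
            fun u => (fun u => g u + (-a) * φ u) u + 1 * (fun _ => c) u := by
          funext u; ring
        rw [e, avgOp_iter_add, avgOp_iter_add, avgOp_iter_const hM]; ring
      rw [h2] at h1
      push_cast
      linarith
  have h0 : 0 ≤ (avgOp U)^[n] g v := by
    have := avgOp_iter_mono U n hg v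
    rwa [avgOp_iter_const hM] at this
  linarith

lemma avgOp_iter_sum {E : Type*} {M : ℕ} (hM : 0 < M) (U : Fin M → E → E) (φ : E → ℝ) (s n : ℕ)
    (v : E) :
    (avgOp U)^[s] (fun u => ∑ t ∈ Finset.range n, (avgOp U)^[t] φ u) v
      = ∑ t ∈ Finset.range n, (avgOp U)^[s + t] φ v := by
  induction n with
  | zero => simp [avgOp_iter_const hM]
  | succ n ih =>
    simp only [Finset.sum_range_succ]
    have := avgOp_iter_add U s (fun u => ∑ t ∈ Finset.range n, (avgOp U)^[t] φ u)
      ((avgOp U)^[n] φ) 1 v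
    simp only [one_mul] at this
    rw [this, ih, Function.iterate_add_apply]

/-- The scalar recursion. -/
lemma scalar_last (k : ℕ) (hk : 1 ≤ k) (F : ℕ → ℝ) (hF : ∀ t, 0 ≤ F t) (ρ : ℝ) (hρ0 : 0 ≤ ρ) (hρ : ρ ≤ 1)
    (H : ∀ s n, s + n = k → ρ * ∑ t ∈ Finset.range (n + 1), F (s + t) ≤ (n + 1 : ℝ) * F s) :
    F k ≤ Real.exp 1 * (∑ t ∈ Finset.range (k + 1), F t) / (k : ℝ) ^ ρ := by
  have key : ∀ s n, s + n = k → F k ≤ (2 / (n + 2 : ℝ)) ^ ρ * ∑ t ∈ Finset.range (n + 1), F (s + t) := by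
    intro s n
    induction n generalizing s with
    | zero => intro h; simp at h; subst h; simp
    | succ n ih =>
      intro h
      have h1 := ih (s + 1) (by omega)
      have h2 := H s (n + 1) h
      have e : ∑ t ∈ Finset.range (n + 1 + 1), F (s + t)
          = (∑ t ∈ Finset.range (n + 1), F (s + 1 + t)) + F s := by
        rw [Finset.sum_range_succ']
        simp only [add_zero]
        congr 1
        apply Finset.sum_congr rfl
        intro t _
        congr 1; ring
      set A := ∑ t ∈ Finset.range (n + 1 + 1), F (s + t) with hA
      have hA0 : 0 ≤ A := Finset.sum_nonneg (fun _ _ => hF _)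
      set B := ∑ t ∈ Finset.range (n + 1), F (s + 1 + t) with hB
      push_cast at h2 ⊢
      have hn : (0 : ℝ) < n + 2 := by positivity
      have h3 : B ≤ (1 - ρ / (n + 2)) * A := by
        have : ρ / (n + 2) * A ≤ F s := by
          rw [div_mul_eq_mul_div, div_le_iff₀ hn]
          linarith
        linarith
      have h4 : 1 - ρ / (n + 2 : ℝ) ≤ ((n + 2 : ℝ) / (n + 3)) ^ ρ := by
        rw [Real.rpow_def_of_pos (by positivity)]
        have l1 := Real.one_sub_inv_le_log_of_pos (show (0 : ℝ) < (n + 2 : ℝ) / (n + 3) by positivity)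
        have l2 : 1 - ((n + 2 : ℝ) / (n + 3))⁻¹ = - (1 / (n + 2)) := by
          field_simp; ring
        rw [l2] at l1
        have l3 := Real.add_one_le_exp (Real.log ((n + 2 : ℝ) / (n + 3)) * ρ)
        have l4 := mul_le_mul_of_nonneg_right l1 hρ0
        have l5 : -(1 / (n + 2 : ℝ)) * ρ = - (ρ / (n + 2)) := by ring
        linarith
      have h5 : (2 / (n + 1 + 2 : ℝ)) ^ ρ = (2 / (n + 2 : ℝ)) ^ ρ * ((n + 2 : ℝ) / (n + 3)) ^ ρ := by
        rw [← Real.mul_rpow (by positivity) (by positivity)]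
        congr 1
        field_simp; ring
      rw [h5, mul_assoc]
      refine h1.trans ?_
      apply mul_le_mul_of_nonneg_left _ (by positivity)
      exact h3.trans (mul_le_mul_of_nonneg_right h4 hA0)
  have h1 := key 0 k (by simp)
  simp only [zero_add] at h1
  have hA0 : 0 ≤ ∑ t ∈ Finset.range (k + 1), F t := Finset.sum_nonneg (fun _ _ => hF _)
  have hk' : (0 : ℝ) < k := by positivity
  refine h1.trans ?_
  rw [mul_div_right_comm]
  apply mul_le_mul_of_nonneg_right _ hA0
  have h2 : (2 / (k + 2 : ℝ)) ^ ρ ≤ (2 / (k : ℝ)) ^ ρ := by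
    apply Real.rpow_le_rpow (by positivity) _ hρ0
    gcongr; linarith
  refine h2.trans ?_
  rw [Real.div_rpow (by norm_num) hk'.le]
  gcongr
  have h3 : (2 : ℝ) ^ ρ ≤ 2 ^ (1 : ℝ) := Real.rpow_le_rpow_of_exponent_le (by norm_num) hρ
  have h4 := Real.add_one_le_exp 1
  rw [Real.rpow_one] at h3
  linarith

lemma sgd_last {E : Type*} [NormedAddCommGroup E] [InnerProductSpace ℝ E] {M : ℕ} (hM : 0 < M)
    (H : Fin M → E →ₗ[ℝ] E) (hs : ∀ m, (H m).IsSymmetric) (Q : ℝ) (hQ0 : 0 ≤ Q) (hQ1 : Q < 1)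
    (hpos : ∀ m v, 0 ≤ inner ℝ (H m v) v)
    (hub : ∀ m v, ‖H m v‖ ^ 2 ≤ Q * inner ℝ (H m v) v) (k : ℕ) (hk : 1 ≤ k) (v : E) :
    (avgOp (fun m v => v - H m v))^[k] (fun u => (∑ m, inner ℝ (H m u) u) / (M : ℝ)) v
      ≤ Real.exp 1 * (‖v‖ ^ 2 / (2 - Q)) / (k : ℝ) ^ (1 - Q * (1 - Q / 4)) := by
  have hM' : (0 : ℝ) < M := by positivity
  set U : Fin M → E → E := fun m v => v - H m v with hU
  set φ : E → ℝ := fun u => (∑ m, inner ℝ (H m u) u) / (M : ℝ) with hφ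
  have hφ0 : ∀ u, 0 ≤ φ u := fun u => div_nonneg (Finset.sum_nonneg fun m _ => hpos m u) hM'.le
  obtain ⟨q, hq⟩ : ∃ q, q = 1 - Q / 2 := ⟨_, rfl⟩
  have hq0 : 0 < q := by rw [hq]; linarith
  have e1 : ∀ m u z, ‖U m u - z‖ ^ 2 ≤ ‖u - z‖ ^ 2 - 2 * q * inner ℝ (H m u) u
      + 2 * inner ℝ (H m u) z := by
    intro m u z
    have : U m u - z = (u - z) - H m u := by simp only [hU]; abel
    rw [this, norm_sub_sq_real, real_inner_comm, inner_sub_right]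
    have := hub m u
    rw [hq]
    linarith
  have e2 : ∀ m u z, ‖U m u - z‖ ^ 2 ≤ ‖u - z‖ ^ 2 - q * inner ℝ (H m u) u
      + (1 / q) * inner ℝ (H m z) z := by
    intro m u z
    have h1 := e1 m u z
    have h2 := hpos m (q • u - z)
    simp only [map_sub, map_smul, inner_sub_left, inner_sub_right, inner_smul_left,
      inner_smul_right] at h2
    have h3 : inner ℝ (H m z) u = inner ℝ (H m u) z := by
      rw [hs m z u, real_inner_comm]
    rw [h3] at h2
    simp at h2
    have h4 : 2 * inner ℝ (H m u) z ≤ q * inner ℝ (H m u) u + (1 / q) * inner ℝ (H m z) z := by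
      have : 2 * q * inner ℝ (H m u) z ≤ q * q * inner ℝ (H m u) u + inner ℝ (H m z) z := by linarith
      have h5 : q * inner ℝ (H m u) u + (1 / q) * inner ℝ (H m z) z
        = (q * q * inner ℝ (H m u) u + inner ℝ (H m z) z) / q := by field_simp
      rw [h5, le_div_iff₀ hq0]; linarith
    linarith
  have avg : ∀ (z : E) (a c : ℝ), (∀ m u, ‖U m u - z‖ ^ 2 ≤ ‖u - z‖ ^ 2 - a * inner ℝ (H m u) u
      + c * inner ℝ (H m z) z) → ∀ u, avgOp U (fun u => ‖u - z‖ ^ 2) u ≤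
      (fun u => ‖u - z‖ ^ 2) u - a * φ u + c * φ z := by
    intro z a c h u
    simp only [avgOp, hφ]
    rw [div_le_iff₀ hM']
    refine (Finset.sum_le_sum fun m _ => h m u).trans (le_of_eq ?_)
    simp only [Finset.sum_add_distrib, Finset.sum_sub_distrib, ← Finset.mul_sum]
    simp
    field_simp
  have s1 : ∀ u n, q * ∑ t ∈ Finset.range n, (avgOp U)^[t] φ u ≤ n * ((1 / q) * φ u) := by
    intro u n
    have := avgOp_telescope hM U (fun w => ‖w - u‖ ^ 2) φ q ((1 / q) * φ u)
      (fun _ => by positivity) (avg u q (1 / q) (fun m w => e2 m w u)) n u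
    simpa using this
  have s2 : 2 * q * ∑ t ∈ Finset.range (k + 1), (avgOp U)^[t] φ v ≤ ‖v‖ ^ 2 := by
    have := avgOp_telescope hM U (fun w => ‖w - 0‖ ^ 2) φ (2 * q) (0 * φ 0)
      (fun _ => by positivity) (avg 0 (2 * q) 0 (fun m w => by simpa using e1 m w 0)) (k + 1) v
    simpa using this
  have hρ : 1 - Q * (1 - Q / 4) = q ^ 2 := by rw [hq]; ring
  rw [hρ]
  have main := scalar_last k hk (fun t => (avgOp U)^[t] φ v) (fun t => by
      have := avgOp_iter_mono U t hφ0 v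
      rwa [avgOp_iter_const hM] at this) (q ^ 2) (by positivity) (by
        rw [hq]; nlinarith) (by
      intro s n _
      have h1 : ∀ u, (fun u => ∑ t ∈ Finset.range (n + 1), (avgOp U)^[t] φ u) u
          ≤ (fun u => (fun _ => (0 : ℝ)) u + ((n + 1 : ℝ) / q ^ 2) * φ u) u := by
        intro u
        have := s1 u (n + 1)
        push_cast at this
        simp only [zero_add]
        rw [div_mul_eq_mul_div, le_div_iff₀ (by positivity)]
        have h6 := mul_le_mul_of_nonneg_left this hq0.le
        have h7 : q * ((n + 1 : ℝ) * (1 / q * φ u)) = (n + 1) * φ u := by field_simp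
        linarith
      have h2 := avgOp_iter_mono U s h1 v
      rw [avgOp_iter_sum hM, avgOp_iter_add, avgOp_iter_const hM, zero_add, div_mul_eq_mul_div,
        le_div_iff₀ (by positivity)] at h2
      linarith)
  refine main.trans ?_
  have h2q : 2 - Q = 2 * q := by rw [hq]; ring
  gcongr
  rw [h2q, le_div_iff₀ (by positivity)]
  linarith

lemma pow_compare (x β : ℝ) (hx0 : 0 ≤ x) (hxβ : x ≤ β) (hβ : β < 1) (N : ℕ) :
    x * (1 - (1 - β) ^ N) ≤ β * (1 - (1 - x) ^ N) := by
  have g : ∀ z : ℝ, 1 - (1 - z) ^ N = z * ∑ j ∈ Finset.range N, (1 - z) ^ j := by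
    intro z
    have := mul_neg_geom_sum (1 - z) N
    rw [← this]; ring
  rw [g, g]
  have : ∑ j ∈ Finset.range N, (1 - β) ^ j ≤ ∑ j ∈ Finset.range N, (1 - x) ^ j := by
    apply Finset.sum_le_sum
    intro j _
    exact pow_le_pow_left₀ (by linarith) (by linarith) j
  have h := mul_le_mul_of_nonneg_left this (mul_nonneg hx0 (hx0.trans hxβ))
  linarith

lemma spectral_facts {E : Type*} [NormedAddCommGroup E] [InnerProductSpace ℝ E]
    [FiniteDimensional ℝ E] (A : E →ₗ[ℝ] E) (hA : A.IsSymmetric) (R γ : ℝ) (hR : 0 < R)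
    (hγ : 0 < γ) (hγR : γ * R ^ 2 < 1) (N : ℕ)
    (hA0 : ∀ v, 0 ≤ inner ℝ (A v) v) (hA1 : ∀ v, inner ℝ (A v) v ≤ R ^ 2 * ‖v‖ ^ 2)
    (H : E →ₗ[ℝ] E) (hH : H = 1 - (1 - γ • A) ^ N) :
    H.IsSymmetric ∧ (∀ v, 0 ≤ inner ℝ (H v) v) ∧
    (∀ v, ‖H v‖ ^ 2 ≤ (1 - (1 - γ * R ^ 2) ^ N) * inner ℝ (H v) v) ∧
    (∀ v, (1 - (1 - γ * R ^ 2) ^ N) * inner ℝ (A v) v ≤ R ^ 2 * inner ℝ (H v) v) := by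
  have hsγ : (1 - γ • A).IsSymmetric := by
    intro u v
    simp [inner_sub_left, inner_sub_right, inner_smul_left, inner_smul_right, hA u v]
  have hs : H.IsSymmetric := by
    rw [hH]
    exact LinearMap.IsSymmetric.sub (fun u v => rfl) (hsγ.pow N)
  set b := hA.eigenvectorBasis rfl with hb
  set l := hA.eigenvalues rfl with hl
  have hbA : ∀ i, A (b i) = l i • b i := fun i => by
    exact hA.apply_eigenvectorBasis rfl i
  have hn : ∀ i, ‖b i‖ = 1 := fun i => b.orthonormal.1 i
  have hl0 : ∀ i, 0 ≤ l i := by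
    intro i
    have := hA0 (b i)
    simpa [hbA, inner_smul_left, hn] using this
  have hl1 : ∀ i, l i ≤ R ^ 2 := by
    intro i
    have := hA1 (b i)
    simpa [hbA, inner_smul_left, hn] using this
  have hbp : ∀ (n : ℕ) i, ((1 - γ • A) ^ n) (b i) = (1 - γ * l i) ^ n • b i := by
    intro n i
    induction n with
    | zero => simp
    | succ n ih =>
      rw [pow_succ', Module.End.mul_apply, ih, map_smul]
      simp only [LinearMap.sub_apply, Module.End.one_apply, LinearMap.smul_apply, hbA]
      module
  set h : _ → ℝ := fun i => 1 - (1 - γ * l i) ^ N with hh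
  have hbH : ∀ i, H (b i) = h i • b i := by
    intro i
    rw [hH, LinearMap.sub_apply, hbp, Module.End.one_apply]
    module
  have cA : ∀ v i, inner ℝ (A v) (b i) = l i * inner ℝ v (b i) := by
    intro v i
    rw [hA v (b i), hbA, inner_smul_right]
  have cH : ∀ v i, inner ℝ (H v) (b i) = h i * inner ℝ v (b i) := by
    intro v i
    rw [hs v (b i), hbH, inner_smul_right]
  have iA : ∀ v, inner ℝ (A v) v = ∑ i, l i * (inner ℝ v (b i)) ^ 2 := by
    intro v
    rw [← b.sum_inner_mul_inner]
    refine Finset.sum_congr rfl fun i _ => ?_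
    rw [cA, real_inner_comm v (b i)]; ring
  have iH : ∀ v, inner ℝ (H v) v = ∑ i, h i * (inner ℝ v (b i)) ^ 2 := by
    intro v
    rw [← b.sum_inner_mul_inner]
    refine Finset.sum_congr rfl fun i _ => ?_
    rw [cH, real_inner_comm v (b i)]; ring
  have iHH : ∀ v, ‖H v‖ ^ 2 = ∑ i, h i ^ 2 * (inner ℝ v (b i)) ^ 2 := by
    intro v
    rw [← real_inner_self_eq_norm_sq, ← b.sum_inner_mul_inner]
    refine Finset.sum_congr rfl fun i _ => ?_
    rw [real_inner_comm (H v) (b i), cH]; ring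
  have x1 : ∀ i, γ * l i ≤ γ * R ^ 2 := fun i => mul_le_mul_of_nonneg_left (hl1 i) hγ.le
  have x0 : ∀ i, 0 ≤ γ * l i := fun i => mul_nonneg hγ.le (hl0 i)
  have h0 : ∀ i, 0 ≤ h i := by
    intro i
    have : (1 - γ * l i) ^ N ≤ 1 := pow_le_one₀ (by linarith [x1 i]) (by linarith [x0 i])
    simp only [hh]; linarith
  have h1 : ∀ i, h i ≤ 1 - (1 - γ * R ^ 2) ^ N := by
    intro i
    have : (1 - γ * R ^ 2) ^ N ≤ (1 - γ * l i) ^ N :=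
      pow_le_pow_left₀ (by linarith) (by linarith [x1 i]) N
    simp only [hh]; linarith
  have h2 : ∀ i, (1 - (1 - γ * R ^ 2) ^ N) * l i ≤ R ^ 2 * h i := by
    intro i
    have := pow_compare _ _ (x0 i) (x1 i) hγR N
    have h3 : γ * ((1 - (1 - γ * R ^ 2) ^ N) * l i) ≤ γ * (R ^ 2 * h i) := by
      simp only [hh]; linarith
    exact le_of_mul_le_mul_left h3 hγ
  refine ⟨hs, ?_, ?_, ?_⟩
  · intro v
    rw [iH]
    exact Finset.sum_nonneg fun i _ => mul_nonneg (h0 i) (sq_nonneg _)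
  · intro v
    rw [iH, iHH, Finset.mul_sum]
    refine Finset.sum_le_sum fun i _ => ?_
    rw [← mul_assoc]
    refine mul_le_mul_of_nonneg_right ?_ (sq_nonneg _)
    rw [sq]
    exact mul_le_mul_of_nonneg_right (h1 i) (h0 i)
  · intro v
    rw [iA, iH, Finset.mul_sum, Finset.mul_sum]
    refine Finset.sum_le_sum fun i _ => ?_
    rw [← mul_assoc, ← mul_assoc]
    exact mul_le_mul_of_nonneg_right (h2 i) (sq_nonneg _)

lemma mulVecE_eq {n d : ℕ} (X : Matrix (Fin n) (Fin d) ℝ) (v : EuclideanSpace ℝ (Fin d)) :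
    mulVecE X v = Matrix.toEuclideanLin X v := rfl

lemma mulVecE_adj {n d : ℕ} (X : Matrix (Fin n) (Fin d) ℝ) (a : EuclideanSpace ℝ (Fin n))
    (v : EuclideanSpace ℝ (Fin d)) :
    inner ℝ (Matrix.toEuclideanLin Xᵀ a) v = inner ℝ a (Matrix.toEuclideanLin X v) := by
  rw [← Matrix.conjTranspose_eq_transpose_of_trivial, Matrix.toEuclideanLin_conjTranspose_eq_adjoint,
    LinearMap.adjoint_inner_left]

end helpers

/-- for `M` jointly realizable tasks with data radius `R`, budgeted
continual linear regression with fixed step size `γ ∈ (0, 1/R²)` and budget `N` under a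
random with-replacement ordering of length `k` satisfies, with `Q = 1 − (1−γR²)^N`,
`E_τ L(w_k) ≤ e‖w₀−w⋆‖²R² / (2(1 − (1−γR²)^{2N}) k^{1−Q(1−Q/4)})`. -/
theorem fixed_budget_rate {d M : ℕ} (hM : 0 < M)
    (nrows : Fin M → ℕ)
    (X : ∀ m : Fin M, Matrix (Fin (nrows m)) (Fin d) ℝ)
    (y : ∀ m : Fin M, EuclideanSpace ℝ (Fin (nrows m)))
    (R : ℝ) (hR : 0 < R)
    (hX : ∀ (m : Fin M) (v : EuclideanSpace ℝ (Fin d)), ‖mulVecE (X m) v‖ ≤ R * ‖v‖)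
    (wstar : EuclideanSpace ℝ (Fin d)) (hreal : ∀ m, mulVecE (X m) wstar = y m)
    (γ : ℝ) (hγ : 0 < γ) (hγR : γ < 1 / R ^ 2)
    (N : ℕ) (hN : 1 ≤ N)
    (k : ℕ) (hk : 1 ≤ k)
    (w0 : EuclideanSpace ℝ (Fin d))
    (w : (Fin k → Fin M) → ℕ → EuclideanSpace ℝ (Fin d))
    (hw0 : ∀ τ, w τ 0 = w0)
    (hwt : ∀ (τ : Fin k → Fin M) (t : Fin k),
      w τ (t.1 + 1) =
        (fun v : EuclideanSpace ℝ (Fin d) =>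
          v - γ • mulVecE (X (τ t))ᵀ (mulVecE (X (τ t)) v - y (τ t)))^[N] (w τ t.1)) :
    (∑ τ : Fin k → Fin M, (1 / (M : ℝ)) * ∑ m, (1 / 2) * ‖mulVecE (X m) (w τ k) - y m‖ ^ 2)
        / (M : ℝ) ^ k
      ≤ Real.exp 1 * ‖w0 - wstar‖ ^ 2 * R ^ 2 /
          (2 * (1 - (1 - γ * R ^ 2) ^ (2 * N)) *
            (k : ℝ) ^ (1 - (1 - (1 - γ * R ^ 2) ^ N) * (1 - (1 - (1 - γ * R ^ 2) ^ N) / 4))) := by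
  have hM' : (0 : ℝ) < M := by positivity
  have hβ : γ * R ^ 2 < 1 := by rwa [lt_div_iff₀ (by positivity)] at hγR
  have hβ0 : 0 < γ * R ^ 2 := by positivity
  set p := (1 - γ * R ^ 2) ^ N with hp
  have hp0 : 0 < p := pow_pos (by linarith) N
  have hp1 : p < 1 := pow_lt_one₀ (by linarith) (by linarith) (by omega)
  set A : Fin M → EuclideanSpace ℝ (Fin d) →ₗ[ℝ] EuclideanSpace ℝ (Fin d) := fun m =>
    (Matrix.toEuclideanLin (X m)ᵀ) ∘ₗ (Matrix.toEuclideanLin (X m)) with hAdef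
  have iA : ∀ m v, inner ℝ (A m v) v = ‖mulVecE (X m) v‖ ^ 2 := by
    intro m v
    rw [hAdef]
    simp only [LinearMap.comp_apply]
    rw [mulVecE_adj, real_inner_self_eq_norm_sq, mulVecE_eq]
  have hAs : ∀ m, (A m).IsSymmetric := by
    intro m u v
    rw [hAdef]
    simp only [LinearMap.comp_apply]
    rw [mulVecE_adj, real_inner_comm, ← mulVecE_adj, real_inner_comm]
  set H : Fin M → EuclideanSpace ℝ (Fin d) →ₗ[ℝ] EuclideanSpace ℝ (Fin d) := fun m =>
    1 - (1 - γ • A m) ^ N with hHdef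
  have facts := fun m => spectral_facts (A m) (hAs m) R γ hR hγ hβ N
    (fun v => by rw [iA]; positivity)
    (fun v => by
      rw [iA, ← mul_pow]
      exact pow_le_pow_left₀ (norm_nonneg _) (hX m v) 2) (H m) rfl
  have step : ∀ m v (n : ℕ), (fun v : EuclideanSpace ℝ (Fin d) =>
          v - γ • mulVecE (X m)ᵀ (mulVecE (X m) v - y m))^[n] v - wstar
        = ((1 - γ • A m) ^ n) (v - wstar) := by
    intro m v n
    induction n with
    | zero => simp
    | succ n ih =>
      rw [Function.iterate_succ_apply', pow_succ', Module.End.mul_apply, ← ih, ← hreal m]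
      generalize (fun v : EuclideanSpace ℝ (Fin d) => v - γ • mulVecE (X m)ᵀ
        (mulVecE (X m) v - mulVecE (X m) wstar))^[n] v = u
      simp only [mulVecE_eq, hAdef, LinearMap.sub_apply, Module.End.one_apply,
        LinearMap.smul_apply, LinearMap.comp_apply, map_sub, smul_sub]
      abel
  have paths := sum_paths hM (fun m v => v - H m v)
    (fun u => (∑ m, inner ℝ (H m u) u) / (M : ℝ)) k (w0 - wstar) (fun τ t => w τ t - wstar)
    (fun τ => by rw [hw0]) (fun τ t => by
      rw [hwt, step]
      simp [hHdef])
  have last := sgd_last hM H (fun m => (facts m).1) (1 - p) (by linarith) (by linarith)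
    (fun m => (facts m).2.1) (fun m => (facts m).2.2.1) k hk (w0 - wstar)
  rw [← paths] at last
  have cmp : ∀ τ, (1 / (M : ℝ)) * ∑ m, (1 / 2) * ‖mulVecE (X m) (w τ k) - y m‖ ^ 2 ≤
      (R ^ 2 / (2 * (1 - p))) * ((∑ m, inner ℝ (H m (w τ k - wstar)) (w τ k - wstar)) / (M : ℝ)) := by
    intro τ
    have : ∀ m, (1 / 2) * ‖mulVecE (X m) (w τ k) - y m‖ ^ 2 ≤
        (R ^ 2 / (2 * (1 - p))) * inner ℝ (H m (w τ k - wstar)) (w τ k - wstar) := by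
      intro m
      have h1 := (facts m).2.2.2 (w τ k - wstar)
      rw [iA] at h1
      have h2 : mulVecE (X m) (w τ k - wstar) = mulVecE (X m) (w τ k) - y m := by
        rw [← hreal m]; simp only [mulVecE_eq, map_sub]
      rw [h2] at h1
      rw [div_mul_eq_mul_div (R ^ 2), le_div_iff₀ (by linarith)]
      linarith
    calc _ ≤ (1 / (M : ℝ)) * ∑ m, (R ^ 2 / (2 * (1 - p))) *
          inner ℝ (H m (w τ k - wstar)) (w τ k - wstar) := by
            exact mul_le_mul_of_nonneg_left (Finset.sum_le_sum fun m _ => this m) (by positivity)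
      _ = _ := by rw [← Finset.mul_sum]; ring
  calc _ ≤ (∑ τ : Fin k → Fin M, (R ^ 2 / (2 * (1 - p))) *
        ((∑ m, inner ℝ (H m (w τ k - wstar)) (w τ k - wstar)) / (M : ℝ))) / (M : ℝ) ^ k := by
        exact div_le_div_of_nonneg_right (Finset.sum_le_sum fun τ _ => cmp τ) (by positivity)
    _ = (R ^ 2 / (2 * (1 - p))) * ((∑ τ : Fin k → Fin M,
        ((∑ m, inner ℝ (H m (w τ k - wstar)) (w τ k - wstar)) / (M : ℝ))) / (M : ℝ) ^ k) := by
        rw [← Finset.mul_sum, mul_div_assoc]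
    _ ≤ (R ^ 2 / (2 * (1 - p))) * _ :=
        mul_le_mul_of_nonneg_left last (div_nonneg (by positivity) (by linarith))
    _ = _ := by
        have hk' : (0 : ℝ) < (k : ℝ) ^ (1 - (1 - p) * (1 - (1 - p) / 4)) := by positivity
        have e : (1 - γ * R ^ 2) ^ (2 * N) = p ^ 2 := by rw [hp, ← pow_mul, mul_comm 2 N]
        rw [e]
        have e2 : 2 - (1 - p) = 1 + p := by ring
        have e3 : 1 - p ^ 2 = (1 - p) * (1 + p) := by ring
        rw [e2, e3]
        have : 1 - p ≠ 0 := by linarith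
        have : 1 + p ≠ 0 := by linarith
        field_simp
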